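/- Suppose k is even and s is a rational number with [m_1, …, m_{k−1}, m_k−1] < s ≤ [m_1, …, m_{k−1}, m_k−1, 2]. Then CS(s) contains (m+1, S_{2e}, S_1, S_2, S_1, S_{2b}, m+1) as a subsequence. -/

import Mathlib

/- Formalization of statements from "Homotopically equivalent simple loops on
2-bridge spheres in Heckoid orbifolds for 2-bridge links (II)" by Lee-Sakuma.

We work in the free group `F` on two generators `a = gen 0`, `b = gen 1`.
For a rational `s` (in lowest terms `q/p`, with `0 ≤ s ≤ 1`), `uWord s` is the
word `u_s = a b^{ε₁} a^{ε₂} ⋯ b^{ε_{2p-1}}` with `ε_i = (-1)^⌊i·s⌋`.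
`CS s` is (a linear representative of) the cyclic sequence of lengths of
maximal constant-sign runs of exponents of `u_s`; since `u_s` begins with a
positive letter and (for `0 < s ≤ 1`) ends with a negative letter, the linear
run-length sequence represents the cyclic one.  `CyclicContains L T` says the
cyclic sequence represented by `L` contains `T` as a block of consecutive
terms.  `cfQ [m₁,…,m_k]` is the continued fraction `1/(m₁+1/(m₂+⋯+1/m_k))`.
`memI1 M n s` / `memI2 M n s` express `s ∈ I₁(r;n)` / `s ∈ I₂(r;n)` where
`r = cfQ M`, and `memI1hat` / `memI2hat` express `s ∈ I₁(r)` / `s ∈ I₂(r)`.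
The Heckoid group `Heck(r;n) = ⟨a,b | u_r^n⟩` is the quotient of `F` by the
normal closure `heckN r n` of `u_r^n`, with quotient map `heckQ r n`. -/

namespace Heckoid

abbrev F : Type := FreeGroup (Fin 2)

/-- The generators: `gen 0 = a`, `gen 1 = b` (and `gen i` depends on parity). -/
def gen (i : ℕ) : F := FreeGroup.of ⟨i % 2, Nat.mod_lt _ (by norm_num)⟩

/-- The word `u_s = a b^{ε₁} a^{ε₂} b^{ε₃} ⋯ a^{ε_{2p-2}} b^{ε_{2p-1}}`,
where `s = q/p` in lowest terms and `ε_i = (-1)^⌊iq/p⌋`. -/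
def uWord (s : ℚ) : F :=
  ((List.range (2 * s.den)).map
    (fun i => gen i ^ ((-1 : ℤ) ^ (⌊(i : ℚ) * s⌋.toNat)))).prod

/-- The sequence of exponent signs `ε₀, ε₁, …, ε_{2p-1}` of `u_s`. -/
def signList (s : ℚ) : List ℤ :=
  (List.range (2 * s.den)).map (fun i => (-1 : ℤ) ^ (⌊(i : ℚ) * s⌋.toNat))

/-- Lengths of the maximal runs of equal consecutive entries. -/
def runLengths {α : Type} [BEq α] (l : List α) : List ℕ :=
  (l.splitBy (· == ·)).map List.length

/-- `CS s = CS(u_s)`: the cyclic sequence of lengths of maximal constant-sign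
runs of `u_s`, represented by a list. -/
def CS (s : ℚ) : List ℕ := runLengths (signList s)

/-- The cyclic sequence represented by `L` contains `T` as a block of
consecutive terms. -/
def CyclicContains (L T : List ℕ) : Prop := ∃ k, T <+: L.rotate k

/-- The continued fraction `[m₁, m₂, …, m_k] = 1/(m₁+1/(m₂+⋯+1/m_k))`. -/
def cfQ : List ℕ → ℚ
  | [] => 0
  | a :: l => 1 / ((a : ℚ) + cfQ l)

/-- `d⟨T, T'⟩`: `d` consecutive repetitions of the concatenation of `T` and `T'`. -/
def rep2 (d : ℕ) (T T' : List ℕ) : List ℕ := (List.replicate d (T ++ T')).flatten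

/-- `s ∈ I₁(r;n)` where `r = cfQ M`:  `[0, [m₁,…,m_{k-1},m_k-1,2]]` for `k` even,
`[0, [m₁,…,m_k,2n-2])` for `k` odd. -/
def memI1 (M : List ℕ) (n : ℕ) (s : ℚ) : Prop :=
  if Even M.length then 0 ≤ s ∧ s ≤ cfQ (M.dropLast ++ [M.getLast! - 1, 2])
  else 0 ≤ s ∧ s < cfQ (M ++ [2 * n - 2])

/-- `s ∈ I₂(r;n)` where `r = cfQ M`: `([m₁,…,m_k,2n-2], 1]` for `k` even,
`[[m₁,…,m_{k-1},m_k-1,2], 1]` for `k` odd. -/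
def memI2 (M : List ℕ) (n : ℕ) (s : ℚ) : Prop :=
  if Even M.length then cfQ (M ++ [2 * n - 2]) < s ∧ s ≤ 1
  else cfQ (M.dropLast ++ [M.getLast! - 1, 2]) ≤ s ∧ s ≤ 1

/-- `s ∈ I₁(r)` where `r = cfQ M`. -/
def memI1hat (M : List ℕ) (s : ℚ) : Prop :=
  if Even M.length then 0 ≤ s ∧ s ≤ cfQ (M.dropLast ++ [M.getLast! - 1])
  else 0 ≤ s ∧ s ≤ cfQ M.dropLast

/-- `s ∈ I₂(r)` where `r = cfQ M`. -/
def memI2hat (M : List ℕ) (s : ℚ) : Prop :=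
  if Even M.length then cfQ M.dropLast ≤ s ∧ s ≤ 1
  else cfQ (M.dropLast ++ [M.getLast! - 1]) ≤ s ∧ s ≤ 1

/-- `ceilDiv P Q j = ⌈j P / Q⌉`, the index at which the `j`-th run of `u_{Q/P}` starts. -/
def ceilDiv (P Q j : ℕ) : ℕ := (j * P + (Q - 1)) / Q

/-- The length of the `j`-th run of `u_{Q/P}`. -/
def runLen (P Q j : ℕ) : ℕ := ceilDiv P Q (j + 1) - ceilDiv P Q j

theorem ceilDiv_le_iff {P Q j i : ℕ} (hQ : 0 < Q) : ceilDiv P Q j ≤ i ↔ j * P ≤ i * Q := by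
  unfold ceilDiv
  rw [← Nat.lt_succ_iff, Nat.div_lt_iff_lt_mul hQ, Nat.succ_mul]
  omega

theorem ceilDiv_eq_of_bounds {P Q j n : ℕ} (hQ : 0 < Q) (h1 : j * P ≤ n * Q)
    (h2 : n * Q < j * P + Q) : ceilDiv P Q j = n := by
  refine le_antisymm ((ceilDiv_le_iff hQ).2 h1) ?_
  unfold ceilDiv
  rw [Nat.le_div_iff_mul_le hQ]
  omega

theorem le_ceilDiv_mul {P Q j : ℕ} (hQ : 0 < Q) : j * P ≤ ceilDiv P Q j * Q :=
  (ceilDiv_le_iff hQ).1 le_rfl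

theorem ceilDiv_mul_lt {P Q j : ℕ} (hQ : 0 < Q) : ceilDiv P Q j * Q < j * P + Q := by
  have := Nat.div_mul_le_self (j * P + (Q - 1)) Q
  unfold ceilDiv
  omega

theorem ceilDiv_mono {P Q : ℕ} (hQ : 0 < Q) : Monotone (ceilDiv P Q) := fun _ _ h =>
  (ceilDiv_le_iff hQ).2 ((Nat.mul_le_mul_right P h).trans (le_ceilDiv_mul hQ))

theorem ceilDiv_zero {P Q : ℕ} (hQ : 0 < Q) : ceilDiv P Q 0 = 0 :=
  ceilDiv_eq_of_bounds hQ (by simp) (by simpa using hQ)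

theorem ceilDiv_add_period {P Q : ℕ} (hQ : 0 < Q) (j : ℕ) :
    ceilDiv P Q (j + Q) = ceilDiv P Q j + P := by
  have h1 := le_ceilDiv_mul (P := P) (j := j) hQ
  have h2 := ceilDiv_mul_lt (P := P) (j := j) hQ
  refine ceilDiv_eq_of_bounds hQ ?_ ?_ <;> nlinarith

theorem runLen_add_period {P Q : ℕ} (hQ : 0 < Q) (j : ℕ) :
    runLen P Q (j + Q) = runLen P Q j := by
  unfold runLen
  rw [add_right_comm, ceilDiv_add_period hQ, ceilDiv_add_period hQ]
  omega

theorem runLen_pos {P Q : ℕ} (hQ : 0 < Q) (h : Q ≤ P) (j : ℕ) : 0 < runLen P Q j := by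
  have h1 := le_ceilDiv_mul (P := P) (j := j + 1) hQ
  have h2 := ceilDiv_mul_lt (P := P) (j := j) hQ
  have : ceilDiv P Q j < ceilDiv P Q (j + 1) := by
    by_contra hc
    have := Nat.mul_le_mul_right Q (not_lt.1 hc)
    nlinarith
  unfold runLen
  omega

theorem map_range_eq_flatten_replicate {α : Type} (C : ℕ → ℕ) (hC : Monotone C) (h0 : C 0 = 0)
    (f g : ℕ → α) (hfg : ∀ i j, C j ≤ i → i < C (j + 1) → f i = g j) (n : ℕ) :
    (List.range (C n)).map f =
      ((List.range n).map fun j => List.replicate (C (j + 1) - C j) (g j)).flatten := by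
  induction n with
  | zero => simp [h0]
  | succ n ih =>
    rw [List.range_succ, List.map_append, List.flatten_append, ← ih]
    have h : C (n + 1) = C n + (C (n + 1) - C n) := by
      have := hC (Nat.le_add_right n 1)
      omega
    conv_lhs => rw [h, List.range_add, List.map_append]
    congr 1
    simp only [List.map_map, List.map_cons, List.map_nil, List.flatten_cons, List.flatten_nil,
      List.append_nil]
    refine List.eq_replicate_iff.2 ⟨by simp, ?_⟩
    simp only [List.mem_map, List.mem_range, Function.comp_apply]
    rintro b ⟨i, hi, rfl⟩
    exact hfg _ _ (by omega) (by omega)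

theorem signList_eq (s : ℚ) : signList s =
    (List.range (2 * s.den)).map fun i : ℕ => (-1 : ℤ) ^ (⌊(i : ℚ) * s⌋.toNat) := by
  simp [signList, ← List.map_eq_flatMap, Function.comp_def]

theorem CS_eq {P Q : ℕ} (hQ : 0 < Q) (hQP : Q ≤ P) (hco : Nat.Coprime Q P) {s : ℚ}
    (hs : s = (Q : ℚ) / P) : CS s = (List.range (2 * Q)).map (runLen P Q) := by
  have hP : 0 < P := hQ.trans_le hQP
  have hden : s.den = P := by
    have := Rat.den_div_eq_of_coprime (a := (Q : ℤ)) (b := (P : ℤ)) (by exact_mod_cast hP)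
      (by simpa using hco)
    rw [hs]
    simpa using this
  have hsign : signList s = ((List.range (2 * Q)).map fun j =>
      List.replicate (runLen P Q j) ((-1 : ℤ) ^ j)).flatten := by
    have h2 : 2 * P = ceilDiv P Q (2 * Q) := by
      rw [ceilDiv_eq_of_bounds (n := 2 * P) hQ] <;> nlinarith
    unfold runLen
    rw [signList_eq, hden, h2]
    refine map_range_eq_flatten_replicate _ (ceilDiv_mono hQ) (ceilDiv_zero hQ) _ _ ?_ _
    intro i j hij hji
    rw [ceilDiv_le_iff hQ] at hij
    rw [← not_le, ceilDiv_le_iff hQ, not_le] at hji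
    have : (⌊(i : ℚ) * s⌋).toNat = j := by
      rw [Int.floor_toNat, hs, ← mul_div_assoc, ← Nat.cast_mul, Nat.floor_div_eq_div]
      exact Nat.div_eq_of_lt_le hij hji
    rw [this]
  have hsplit : (signList s).splitBy (· == ·) = (List.range (2 * Q)).map fun j =>
      List.replicate (runLen P Q j) ((-1 : ℤ) ^ j) := by
    rw [hsign]
    refine List.splitBy_flatten ?_ ?_ ?_
    · simp only [List.mem_map, not_exists, not_and, List.replicate_eq_nil_iff]
      intro j _ h
      exact (runLen_pos hQ hQP j).ne' h
    · simp only [List.mem_map]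
      rintro _ ⟨j, _, rfl⟩
      exact List.isChain_replicate_of_rel _ (by simp)
    · rw [List.isChain_iff_getElem]
      intro i hi
      have h1 := (runLen_pos hQ hQP i).ne'
      have h2 := (runLen_pos hQ hQP (i + 1)).ne'
      refine ⟨by simpa using h1, by simpa using h2, ?_⟩
      simp only [List.getElem_map, List.getElem_range, List.getLast_replicate,
        List.head_replicate, beq_eq_false_iff_ne, pow_succ]
      have : (-1 : ℤ) ^ i ≠ 0 := by positivity
      omega
  unfold CS runLengths
  rw [hsplit, List.map_map]
  simp [Function.comp_def]

theorem rotate_map_range {α : Type} (c : ℕ → α) (n : ℕ) (hc : ∀ i, c (i + n) = c i) (k : ℕ) :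
    ((List.range n).map c).rotate k = (List.range n).map fun i => c (k + i) := by
  have hmod (i : ℕ) : c (i % n) = c i := by
    conv_rhs => rw [← Nat.mod_add_div i n]
    generalize i / n = d
    induction d with
    | zero => simp
    | succ d ih => rw [Nat.mul_succ, ← add_assoc, hc, ih]
  refine List.ext_getElem (by simp) fun i h1 h2 => ?_
  simp [List.getElem_rotate, hmod, add_comm]

theorem add_reflect_of_palindrome {C : ℕ → ℕ} (hC : Monotone C) (t u : ℕ)
    (h : ((List.range u).map fun j => C (t + j + 1) - C (t + j)).reverse =
      (List.range u).map fun j => C (t + j + 1) - C (t + j)) (j : ℕ) (hj : j ≤ u) :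
    C (t + j) + C (t + (u - j)) = C t + C (t + u) := by
  induction j with
  | zero => simp
  | succ j ih =>
    have hg := List.getElem_of_eq h (i := j) (by simpa using hj)
    simp only [List.getElem_reverse, List.getElem_map, List.getElem_range, List.length_map,
      List.length_range] at hg
    have e : t + (u - j) = t + (u - 1 - j) + 1 := by omega
    have e' : u - (j + 1) = u - 1 - j := by omega
    have h1 := hC (Nat.le_add_right (t + (u - 1 - j)) 1)
    have h2 := hC (Nat.le_add_right (t + j) 1)
    have := ih (by omega)
    rw [e] at this
    rw [e', ← add_assoc t j 1]
    omega

/-- Evaluating a continued fraction with a fixed initial segment is a Möbius map in the tail. -/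
theorem cfQ_append (l : List ℕ) (hl : ∀ x ∈ l, 0 < x) : ∃ a b c d : ℕ,
    (∀ t, 0 ≤ cfQ t → cfQ (l ++ t) = (a + b * cfQ t) / (c + d * cfQ t)) ∧
    (b * c - a * d : ℤ) = (-1) ^ l.length ∧ 0 < c ∧ (l ≠ [] → 0 < a ∧ a ≤ c ∧ b ≤ d) := by
  induction l with
  | nil => exact ⟨0, 1, 1, 0, by simp, by simp, by simp, by simp⟩
  | cons x l ih =>
    obtain ⟨a, b, c, d, h1, h2, h3, -⟩ := ih fun y hy => hl y (by simp [hy])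
    have hx : 0 < x := hl x (by simp)
    refine ⟨c, d, x * c + a, x * d + b, ?_, ?_, by positivity, fun _ => ⟨h3, ?_, ?_⟩⟩
    · intro t ht
      have hc : (0 : ℚ) < c := by exact_mod_cast h3
      have hx' : (0 : ℚ) < x := by exact_mod_cast hx
      have hpos : (0 : ℚ) < c + d * cfQ t := by positivity
      have hpos' : (0 : ℚ) < (x * c + a : ℚ) + (x * d + b) * cfQ t := by positivity
      rw [List.cons_append, cfQ, h1 t ht]
      push_cast
      have : (x : ℚ) + (a + b * cfQ t) / (c + d * cfQ t)
          = ((x * c + a : ℚ) + (x * d + b) * cfQ t) / (c + d * cfQ t) := by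
        field_simp
        ring
      rw [this, one_div_div]
    · rw [List.length_cons, pow_succ, ← h2]
      push_cast
      ring
    · nlinarith
    · nlinarith

/-- The first `2q + q'` run boundaries of `u_{Q/P}` after the index `Q - (q + q')`, compared with
those of `u_{q/p}` after the index `q - q'`, when `q'/p' < Q/P ≤ (q + q')/(p + p')`. -/
theorem ceilDiv_shift {p q p' q' P Q : ℕ} (hq : q' < q) (hp : p' ≤ p)
    (hdet : p' * q = p * q' + 1) (h1 : q' * P < p' * Q)
    (h2 : (p + p') * Q ≤ (q + q') * P) (h3 : q + q' ≤ Q) (h4 : p + p' ≤ P) (h5 : 0 < q') :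
    ceilDiv P Q (Q - (q + q')) = P - (p + p') ∧
    (∀ i, 1 ≤ i → i < 2 * q + q' → ceilDiv P Q (Q - (q + q') + i) + (p - p') =
      P - (p + p') + ceilDiv p q (q - q' + i)) ∧
    ceilDiv P Q (Q - (q + q') + (2 * q + q')) = P - (p + p') + (2 * p + p' + 1) := by
  have hQ : 0 < Q := by omega
  have hq0 : 0 < q := by omega
  obtain ⟨k, rfl⟩ := Nat.exists_eq_add_of_le h3
  obtain ⟨N, rfl⟩ := Nat.exists_eq_add_of_le h4
  obtain ⟨l, rfl⟩ := Nat.exists_eq_add_of_le hq.le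
  obtain ⟨v, rfl⟩ := Nat.exists_eq_add_of_le hp
  simp only [Nat.add_sub_cancel_left]
  generalize hQQ : q' + l + q' + k = Q at *
  generalize hPP : p' + v + p' + N = P at *
  zify at *
  obtain ⟨a, ha⟩ : ∃ a : ℤ, a = (q' + l) * P - (p' + v) * Q := ⟨_, rfl⟩
  obtain ⟨b, hb⟩ : ∃ b : ℤ, b = p' * Q - q' * P := ⟨_, rfl⟩
  have hb0 : 0 < b := by linarith
  have hab : b ≤ a := by linarith
  have hQab : (Q : ℤ) = q' * a + (q' + l) * b := by
    rw [ha, hb]; linear_combination (-(Q : ℤ)) * hdet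
  have hPab : (P : ℤ) = p' * a + (p' + v) * b := by
    rw [ha, hb]; linear_combination (-(P : ℤ)) * hdet
  have haQ : a ≤ Q := by nlinarith
  have hk : (k : ℤ) = Q - (2 * q' + l) := by linarith
  have hN : (N : ℤ) = P - (2 * p' + v) := by linarith
  have key (x y : ℕ) (hlo : 0 ≤ (y * Q - x * P : ℤ) + (a - b))
      (hhi : (y * Q - x * P : ℤ) + (a - b) < Q) :
      ceilDiv P Q (k + x) = N + y := by
    refine ceilDiv_eq_of_bounds (by exact_mod_cast hQ) ?_ ?_ <;>
    · zify
      rw [hk, hN]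
      nlinarith
  refine ⟨?_, ?_, ?_⟩
  · have := key 0 0 (by push_cast; linarith) (by push_cast; linarith)
    exact_mod_cast this
  · intro i hi1 hi2
    have hM1 := le_ceilDiv_mul (P := p' + v) (Q := q' + l) (j := l + i) (by exact_mod_cast hq0)
    have hM2 := ceilDiv_mul_lt (P := p' + v) (Q := q' + l) (j := l + i) (by exact_mod_cast hq0)
    generalize hM : ceilDiv (p' + v) (q' + l) (l + i) = M at *
    zify at hM1 hM2
    obtain ⟨α, hα⟩ : ∃ α : ℤ, α = i * p' - (M - v) * q' := ⟨_, rfl⟩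
    obtain ⟨β, hβ⟩ : ∃ β : ℤ, β = (M - v) * (q' + l) - i * (p' + v) := ⟨_, rfl⟩
    have hdet' : (p' * l : ℤ) = v * q' + 1 := by linarith
    have hi : (i : ℤ) = α * (q' + l) + β * q' := by
      rw [hα, hβ]; linear_combination (-(i : ℤ)) * hdet'
    have hn : (M : ℤ) - v = α * (p' + v) + β * p' := by
      rw [hα, hβ]; linear_combination (-(M - v : ℤ)) * hdet'
    have hβ1 : 1 ≤ β := by rw [hβ]; linarith
    have hβ2 : β ≤ q' + l := by rw [hβ]; linarith
    have hα1 : α ≤ 1 := by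
      by_contra hc
      have h2α : 0 ≤ α - 2 := by omega
      have e1 := mul_nonneg h2α hq0.le
      have e2 := mul_nonneg (sub_nonneg.2 hβ1) h5.le
      linarith
    have hα2 : 1 - (q' : ℤ) ≤ α := by
      by_contra hc
      have hα0 : 0 ≤ -α - q' := by omega
      have e1 := mul_nonneg hα0 hq0.le
      have e2 := mul_nonneg (sub_nonneg.2 hβ2) h5.le
      linarith
    have hvM : v ≤ M := by
      by_contra hc
      have hM0 : 0 ≤ (v : ℤ) - M - 1 := by omega
      have e1 := mul_nonneg hM0 hq0.le
      have e2 : (0 : ℤ) ≤ i * (p' + v) := by positivity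
      linarith
    obtain ⟨n, rfl⟩ := Nat.exists_eq_add_of_le hvM
    have hval : (n * Q - i * P : ℤ) = β * b - α * a := by
      have hn' : (n : ℤ) = α * (p' + v) + β * p' := by rw [← hn]; push_cast; ring
      rw [hn', hi, ha, hb]; ring
    have e1 := mul_nonneg (sub_nonneg.2 hβ1) hb0.le
    have e2 := mul_nonneg (sub_nonneg.2 hα1) (hb0.le.trans hab)
    have e3 := mul_nonneg (sub_nonneg.2 hβ2) hb0.le
    have e4 := mul_nonneg (sub_nonneg.2 hα2) (hb0.le.trans hab)
    have := key i n (by rw [hval]; linarith) (by rw [hval, hQab]; linarith)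
    rw [this]
    push_cast
    ring
  · have hval : ((2 * (p' + v) + p' + 1 : ℕ) * Q - (2 * (q' + l) + q' : ℕ) * P : ℤ)
        = Q + b - 2 * a := by
      push_cast; rw [ha, hb]; ring
    have := key (2 * (q' + l) + q') (2 * (p' + v) + p' + 1) (by rw [hval]; linarith)
      (by rw [hval]; linarith)
    exact_mod_cast this

/-- The fraction attached to a continued fraction of even length, together with its left Farey
parent `[m₁, …, m_k - 1]` and their mediant `[m₁, …, m_k - 1, 2]`. -/
theorem exists_farey_parent (M : List ℕ) (hMlen : 2 ≤ M.length) (hMpos : ∀ x ∈ M, 0 < x)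
    (hMlast : 2 ≤ M.getLast!) (hk : Even M.length) : ∃ p q p' q' : ℕ,
    0 < q' ∧ q' < q ∧ p' ≤ p ∧ q ≤ p ∧ q' ≤ p' ∧ p' * q = p * q' + 1 ∧
    cfQ M = (q : ℚ) / p ∧ cfQ (M.dropLast ++ [M.getLast! - 1]) = (q' : ℚ) / p' ∧
    cfQ (M.dropLast ++ [M.getLast! - 1, 2]) = ((q + q' : ℕ) : ℚ) / (p + p' : ℕ) := by
  have hne : M ≠ [] := by rintro rfl; simp at hMlen
  obtain ⟨a, b, c, d, hcf, hdet, hc, hne'⟩ := cfQ_append M.dropLast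
    fun x hx => hMpos x (List.mem_of_mem_dropLast hx)
  have hdne : M.dropLast ≠ [] := by
    intro h
    have := congrArg List.length h
    simp at this
    omega
  obtain ⟨ha, hac, hbd⟩ := hne' hdne
  have hodd : Odd M.dropLast.length := by
    rw [List.length_dropLast]
    exact Nat.Even.sub_odd (by omega) hk odd_one
  rw [hodd.neg_one_pow] at hdet
  have hM : M = M.dropLast ++ [M.getLast!] := by
    rw [List.getLast!_of_getLast?, List.dropLast_append_getLast hne]
    exact List.getLast?_eq_some_getLast hne
  obtain ⟨y, hy⟩ := Nat.exists_eq_add_of_le hMlast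
  rw [hy] at hM ⊢
  have hy1 : 2 + y - 1 = y + 1 := by omega
  rw [hy1]
  have hcpos : (0 : ℚ) < c := by exact_mod_cast hc
  refine ⟨c * (2 + y) + d, a * (2 + y) + b, c * (y + 1) + d, a * (y + 1) + b, by positivity,
    by nlinarith, by nlinarith, by nlinarith, by nlinarith, ?_, ?_, ?_, ?_⟩
  · zify
    linear_combination -hdet
  · rw [hM, hcf _ (by simp only [cfQ]; positivity)]
    simp only [cfQ]
    push_cast
    field_simp
    ring
  · rw [hcf _ (by simp only [cfQ]; positivity)]
    simp only [cfQ]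
    push_cast
    field_simp
    ring
  · rw [hcf _ (by simp only [cfQ]; positivity)]
    simp only [cfQ]
    push_cast
    field_simp
    ring

theorem ceilDiv_sub_eq {p q p' q' : ℕ} (h5 : 0 < q') (hq : q' < q) (hp : p' ≤ p)
    (hdet : p' * q = p * q' + 1) : ceilDiv p q (q - q') = p - p' + 1 := by
  obtain ⟨l, rfl⟩ := Nat.exists_eq_add_of_le hq.le
  obtain ⟨v, rfl⟩ := Nat.exists_eq_add_of_le hp
  simp only [Nat.add_sub_cancel_left]
  exact ceilDiv_eq_of_bounds (by omega) (by nlinarith) (by nlinarith)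

/-- The run lengths of `u_{Q/P}` starting from the index `Q - (q + q')`, compared with those of
`u_{q/p}` starting from the index `q - q'`. -/
theorem runLen_shift {p q p' q' P Q : ℕ} (hq : q' < q) (hp : p' ≤ p)
    (hdet : p' * q = p * q' + 1) (h1 : q' * P < p' * Q)
    (h2 : (p + p') * Q ≤ (q + q') * P) (h3 : q + q' ≤ Q) (h4 : p + p' ≤ P) (h5 : 0 < q') :
    runLen P Q (Q - (q + q')) = runLen p q (q - q') + 1 ∧
    (∀ i, 1 ≤ i → i + 1 < 2 * q + q' →
      runLen P Q (Q - (q + q') + i) = runLen p q (q - q' + i)) ∧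
    runLen P Q (Q - (q + q') + (2 * q + q' - 1)) = runLen p q (q - 1) + 1 := by
  have hq0 : 0 < q := by omega
  obtain ⟨f0, fm, fl⟩ := ceilDiv_shift hq hp hdet h1 h2 h3 h4 h5
  have hl := ceilDiv_sub_eq h5 hq hp hdet
  have hmono (i : ℕ) : ceilDiv p q i ≤ ceilDiv p q (i + 1) := ceilDiv_mono hq0 (Nat.le_add_right i 1)
  refine ⟨?_, fun i hi1 hi2 => ?_, ?_⟩
  · have := fm 1 le_rfl (by omega)
    have := hmono (q - q')
    unfold runLen
    omega
  · have e1 := fm i hi1 (by omega)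
    have e2 := fm (i + 1) (by omega) (by omega)
    have := hmono (q - q' + i)
    simp only [← add_assoc] at e2
    unfold runLen
    omega
  · have e1 := fm (2 * q + q' - 1) (by omega) (by omega)
    have e2 : ceilDiv p q (q - q' + (2 * q + q' - 1)) = ceilDiv p q (q - 1) + 2 * p := by
      rw [show q - q' + (2 * q + q' - 1) = q - 1 + q + q by omega, ceilDiv_add_period hq0,
        ceilDiv_add_period hq0]
      ring
    have e3 : ceilDiv p q (q - 1 + 1) = p := by
      rw [show q - 1 + 1 = 0 + q by omega, ceilDiv_add_period hq0, ceilDiv_zero hq0, zero_add]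
    have := hmono (q - 1)
    rw [show 2 * q + q' = 2 * q + q' - 1 + 1 by omega, ← add_assoc] at fl
    unfold runLen
    omega

/-- Reduced fractions strictly above `q'/p'` and at most the mediant of Farey neighbours. -/
theorem farey_bounds {p q p' q' P Q : ℕ} (hdet : p' * q = p * q' + 1) (h1 : q' * P < p' * Q)
    (h2 : (p + p') * Q ≤ (q + q') * P) : q + q' ≤ Q ∧ p + p' ≤ P := by
  zify at *
  obtain ⟨a, ha⟩ : ∃ a : ℤ, a = q * P - p * Q := ⟨_, rfl⟩
  obtain ⟨b, hb⟩ : ∃ b : ℤ, b = p' * Q - q' * P := ⟨_, rfl⟩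
  have hb0 : 1 ≤ b := by linarith
  have ha0 : 1 ≤ a := by linarith
  have hQab : (Q : ℤ) = q' * a + q * b := by
    rw [ha, hb]; linear_combination (-(Q : ℤ)) * hdet
  have hPab : (P : ℤ) = p' * a + p * b := by
    rw [ha, hb]; linear_combination (-(P : ℤ)) * hdet
  constructor <;> nlinarith

/-- A decomposition of a half period of `CS (q / p)` into two palindromes is cut at the index
`ℓ = q - q'` with `ℓ p ≡ 1` modulo `q`. -/
theorem palindrome_cut {p q p' q' t u : ℕ} (h5 : 0 < q') (hq : q' < q) (hp : p' ≤ p)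
    (hdet : p' * q = p * q' + 1) (htu : t + u = q) (ht : 0 < t) (hu : 0 < u)
    (h1 : ((List.range t).map (runLen p q)).reverse = (List.range t).map (runLen p q))
    (h2 : ((List.range u).map fun j => runLen p q (t + j)).reverse =
      (List.range u).map fun j => runLen p q (t + j)) : u = q' := by
  have hq0 : 0 < q := by omega
  have hC := ceilDiv_mono (P := p) hq0
  have h0 := ceilDiv_zero (P := p) hq0
  obtain ⟨l, rfl⟩ := Nat.exists_eq_add_of_le hq.le
  obtain ⟨v, rfl⟩ := Nat.exists_eq_add_of_le hp
  have hl : ceilDiv (p' + v) (q' + l) l = v + 1 := by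
    simpa using ceilDiv_sub_eq h5 hq hp hdet
  have hqq : ceilDiv (p' + v) (q' + l) (q' + l) = p' + v :=
    ceilDiv_eq_of_bounds hq0 (by nlinarith) (by nlinarith)
  have b1 := le_ceilDiv_mul (P := p' + v) (j := t) hq0
  have b2 := ceilDiv_mul_lt (P := p' + v) (j := t) hq0
  have hcop : IsCoprime ((q' + l : ℕ) : ℤ) ((p' + v : ℕ) : ℤ) :=
    ⟨p', -q', by zify at hdet; push_cast; linarith⟩
  have conclude (D : ℤ) (h : ((t : ℤ) - l) * (p' + v : ℕ) = D * (q' + l : ℕ)) : u = q' := by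
    have hdvd : ((q' + l : ℕ) : ℤ) ∣ (t : ℤ) - l :=
      hcop.dvd_of_dvd_mul_right (Dvd.intro_left D h.symm)
    have := Int.eq_zero_of_abs_lt_dvd hdvd (by rw [abs_lt]; push_cast; omega)
    omega
  rcases le_total l t with hlt | hlt
  · have hr := add_reflect_of_palindrome hC 0 t (by simp only [zero_add]; exact h1) l hlt
    simp only [zero_add, h0, hl] at hr
    have b3 := le_ceilDiv_mul (P := p' + v) (j := t - l) hq0
    obtain ⟨e, rfl⟩ := Nat.exists_eq_add_of_le hlt
    simp only [Nat.add_sub_cancel_left] at hr b3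
    refine conclude (ceilDiv (p' + v) (q' + l) e) ?_
    rw [← hr] at b1 b2
    zify at *
    refine le_antisymm (by linarith) (by linarith)
  · have hr := add_reflect_of_palindrome hC t u h2 (l - t) (by omega)
    rw [htu, hqq, show t + (l - t) = l by omega, hl] at hr
    have b3 := le_ceilDiv_mul (P := p' + v) (j := t + (u - (l - t))) hq0
    rw [show t + (u - (l - t)) = q' + t by omega] at hr b3
    generalize ceilDiv (p' + v) (q' + l) (q' + t) = x at *
    generalize ceilDiv (p' + v) (q' + l) t = y at *
    refine conclude (x - (p' + v)) ?_
    zify at hr b1 b2 b3 hdet ⊢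
    have hx : (x : ℤ) = y + p' - 1 := by linarith
    rw [hx] at b3 ⊢
    refine le_antisymm (by linarith) (by linarith)

/-- Lemma 2.4(1): if `k` is even and `[m₁,…,m_k-1] < s ≤ [m₁,…,m_k-1,2]`, then
`CS(s)` contains `(m+1, S₂ₑ, S₁, S₂, S₁, S₂_b, m+1)` as a subsequence, where
`S₂ = (m, S₂ₑ) = (S₂_b, m)`. -/
theorem statement5
    (M : List ℕ) (m n : ℕ) (r : ℚ)
    (hMlen : 2 ≤ M.length) (hMpos : ∀ x ∈ M, 0 < x) (hMlast : 2 ≤ M.getLast!)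
    (hm : M.head? = some m) (hn : 2 ≤ n) (hr : r = cfQ M)
    (S1 S2 : List ℕ) (hdec : CS r = S1 ++ S2 ++ S1 ++ S2)
    (hS1ne : S1 ≠ []) (hS2ne : S2 ≠ [])
    (hS1pal : S1.reverse = S1) (hS2pal : S2.reverse = S2)
    (hS1h : S1.head? = some (m + 1)) (hS2h : S2.head? = some m)
    (hk : Even M.length) (s : ℚ)
    (hs1 : cfQ (M.dropLast ++ [M.getLast! - 1]) < s)
    (hs2 : s ≤ cfQ (M.dropLast ++ [M.getLast! - 1, 2])) :
    CyclicContains (CS s)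
      ([m + 1] ++ S2.tail ++ S1 ++ S2 ++ S1 ++ S2.dropLast ++ [m + 1]) := by
  obtain ⟨p, q, p', q', h5, hq, hp, hqp, hqp', hdet, hcr, hcl, hcm⟩ :=
    exists_farey_parent M hMlen hMpos hMlast hk
  have hq0 : 0 < q := by omega
  have hp0 : 0 < p' := by omega
  have hco : Nat.Coprime q p := by
    rw [← Nat.isCoprime_iff_coprime]
    exact ⟨p', -q', by zify at hdet; linarith⟩
  rw [CS_eq hq0 hqp hco (hr.trans hcr)] at hdec
  obtain ⟨t, ht⟩ : ∃ t, t = S1.length := ⟨_, rfl⟩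
  obtain ⟨u, hu⟩ : ∃ u, u = S2.length := ⟨_, rfl⟩
  have ht0 : 0 < t := ht ▸ List.length_pos_iff.2 hS1ne
  have hu0 : 0 < u := hu ▸ List.length_pos_iff.2 hS2ne
  have htu : t + u = q := by
    have := congrArg List.length hdec
    simp at this
    omega
  rw [show 2 * q = t + (u + q) by omega, List.range_add, List.range_add, List.append_assoc,
    List.append_assoc] at hdec
  simp only [List.map_append, List.map_map] at hdec
  obtain ⟨hS1, hdec⟩ := List.append_inj hdec (by simp [ht])
  obtain ⟨hS2, -⟩ := List.append_inj hdec (by simp [hu])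
  rw [← hS1] at hS1pal
  rw [← hS2] at hS2pal hS2h
  have hu' : u = q' := palindrome_cut h5 hq hp hdet htu ht0 hu0 hS1pal hS2pal
  subst hu'
  obtain ⟨w, rfl⟩ : ∃ w, u = w + 1 := ⟨u - 1, by omega⟩
  have htq : q - (w + 1) = t := by omega
  have hfirst : runLen p q t = m := by
    simpa [List.range_succ_eq_map] using hS2h
  have hlast : runLen p q (q - 1) = m := by
    rw [← hS2pal, List.head?_reverse] at hS2h
    simpa [List.range_succ, ← htu, ← add_assoc] using hS2h
  have hs0 : 0 < s := lt_of_le_of_lt (by rw [hcl]; positivity) hs1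
  obtain ⟨Q, hQ⟩ : ∃ Q : ℕ, (Q : ℤ) = s.num := ⟨s.num.toNat, Int.toNat_of_nonneg (Rat.num_pos.2 hs0).le⟩
  obtain ⟨P, hP⟩ : ∃ P : ℕ, P = s.den := ⟨_, rfl⟩
  have hsQP : s = (Q : ℚ) / P := by
    conv_lhs => rw [← Rat.num_div_den s, ← hQ, ← hP]
    simp
  have hP0 : 0 < P := hP ▸ s.den_pos
  have hcoQP : Nat.Coprime Q P := by
    have := s.reduced
    rwa [← hQ, ← hP, Int.natAbs_natCast] at this
  have h1 : (w + 1) * P < p' * Q := by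
    rw [hcl, hsQP, div_lt_div_iff₀ (by positivity) (by positivity)] at hs1
    rw [mul_comm p']
    exact_mod_cast hs1
  have h2 : (p + p') * Q ≤ (q + (w + 1)) * P := by
    rw [hcm, hsQP, div_le_div_iff₀ (by positivity) (by positivity)] at hs2
    rw [mul_comm (p + p')]
    exact_mod_cast hs2
  obtain ⟨h3, h4⟩ := farey_bounds hdet h1 h2
  have hQP : Q ≤ P := by
    have : (q + (w + 1)) * P ≤ (p + p') * P := Nat.mul_le_mul_right P (by omega)
    exact Nat.le_of_mul_le_mul_left (h2.trans this) (by omega)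
  have hQ0 : 0 < Q := by omega
  obtain ⟨r0, rm, rl⟩ := runLen_shift hq hp hdet h1 h2 h3 h4 h5
  rw [htq, hfirst] at r0
  rw [hlast] at rl
  refine ⟨Q - (q + (w + 1)), ?_⟩
  generalize Q - (q + (w + 1)) = k at *
  rw [CS_eq hQ0 hQP hcoQP hsQP, rotate_map_range _ _ fun i => by
    rw [two_mul, ← add_assoc, runLen_add_period hQ0, runLen_add_period hQ0]]
  have mid (i j d : ℕ) (hi : 1 ≤ i) (hi' : i + 1 < 2 * q + (w + 1)) (hd : t + i = j + d * q) :
      runLen P Q (k + i) = runLen p q j := by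
    rw [rm i hi hi', htq, hd]
    clear hd
    induction d with
    | zero => simp
    | succ d ih => rw [Nat.succ_mul, ← add_assoc, runLen_add_period hq0, ih]
  obtain ⟨e, he⟩ : ∃ e, 2 * Q = 1 + w + t + (w + 1) + t + w + 1 + e :=
    Nat.exists_eq_add_of_le (by omega)
  have hsplit (f : ℕ → ℕ) (x y : ℕ) : (List.range (x + y)).map f =
      (List.range x).map f ++ (List.range y).map fun i => f (x + i) := by
    rw [List.range_add, List.map_append, List.map_map]
    rfl
  have htail : S2.tail = (List.range w).map fun i => runLen p q (t + 1 + i) := by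
    rw [← hS2, List.range_succ_eq_map]
    simp [Function.comp_def, Nat.succ_eq_add_one, add_assoc, add_comm 1]
  have hdrop : S2.dropLast = (List.range w).map fun i => runLen p q (t + i) := by
    rw [← hS2, List.range_succ]
    simp [Function.comp_def]
  rw [htail, hdrop, ← hS1, ← hS2, he]
  obtain ⟨f, hf⟩ : ∃ f : ℕ → ℕ, f = fun i => runLen P Q (k + i) := ⟨_, rfl⟩
  rw [← hf, hsplit f _ e]
  refine ⟨_, congrArg (· ++ _) ?_⟩
  rw [hsplit f _ 1, hsplit f _ w, hsplit f _ t, hsplit f _ (w + 1), hsplit f _ t, hsplit f _ w]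
  subst hf
  congr 1
  · congr 1
    · congr 1
      · congr 1
        · congr 1
          · congr 1
            · simp [r0]
            · refine List.map_congr_left fun i hi => ?_
              rw [List.mem_range] at hi
              exact (mid _ _ 0 (by omega) (by omega) (by omega)).symm
          · refine List.map_congr_left fun i hi => ?_
            rw [List.mem_range] at hi
            exact (mid _ _ 1 (by omega) (by omega) (by omega)).symm
        · refine List.map_congr_left fun i hi => ?_
          rw [List.mem_range] at hi
          exact (mid _ _ 1 (by omega) (by omega) (by simp only; omega)).symm
      · refine List.map_congr_left fun i hi => ?_
        rw [List.mem_range] at hi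
        exact (mid _ _ 2 (by omega) (by omega) (by omega)).symm
    · refine List.map_congr_left fun i hi => ?_
      rw [List.mem_range] at hi
      exact (mid _ _ 2 (by omega) (by omega) (by omega)).symm
  · rw [show 2 * q + (w + 1) - 1 = 1 + w + t + (w + 1) + t + w by omega] at rl
    simp [rl]

end Heckoid
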